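/- Let $(\mathcal{Z},d)$ be a metric space, let $a<b$, and let $z:[a,b]\to\mathcal{Z}$ be continuous with the property that for every $\varepsilon>0$ there exists $t\in(a,a+\varepsilon]$ with $z_t\ne z_a$. Then for every $\alpha\in(0,1)$ there exists a bounded continuous function $h:\mathcal{Z}\to\mathbb{R}$ with $h(z_a)=0$ such that $\sup_{t\in(a,b]}\,|h(z_t)-h(z_a)|/(t-a)^{\alpha}=\infty$; in particular, $t\mapsto h(z_t)$ is not $\alpha$-Hölder continuous on $[a,b]$. -/

import Mathlib

/-- Given points `y n` all different from `p`, some bounded continuous function vanishes at `p` and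
is at least `(1 / 2) ^ n` at `y n` for every `n`. -/
theorem exists_continuous_bounded_geometric_lower_bound {Z : Type*} [MetricSpace Z] (p : Z)
    (y : ℕ → Z) (hy : ∀ n, y n ≠ p) :
    ∃ h : Z → ℝ, Continuous h ∧ (∃ M : ℝ, ∀ x : Z, |h x| ≤ M) ∧ h p = 0 ∧
      ∀ n, (1 / 2 : ℝ) ^ n ≤ h (y n) := by
  set f : ℕ → Z → ℝ := fun n x => (1 / 2) ^ n * min 1 (dist x p / dist (y n) p) with hf
  have hnonneg : ∀ n x, 0 ≤ f n x := fun n x => by positivity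
  have hle : ∀ n x, f n x ≤ (1 / 2) ^ n := fun n x =>
    mul_le_of_le_one_right (by positivity) (min_le_left _ _)
  have hsum : ∀ x, Summable fun n => f n x := fun x =>
    Summable.of_nonneg_of_le (fun n => hnonneg n x) (fun n => hle n x) summable_geometric_two
  refine ⟨fun x => ∑' n, f n x, ?_, ⟨2, fun x => ?_⟩, by simp [hf], fun n => ?_⟩
  · refine continuous_tsum (fun n => by fun_prop) summable_geometric_two fun n x => ?_
    rw [Real.norm_of_nonneg (hnonneg n x)]
    exact hle n x
  · rw [abs_of_nonneg (tsum_nonneg fun n => hnonneg n x), ← tsum_geometric_two]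
    exact (hsum x).tsum_le_tsum (fun n => hle n x) summable_geometric_two
  · calc (1 / 2 : ℝ) ^ n = f n (y n) := by simp [hf, div_self (dist_ne_zero.2 (hy n))]
      _ ≤ ∑' m, f m (y n) := (hsum (y n)).le_tsum n fun m _ => hnonneg m (y n)


/-- Let `(Z, d)` be a metric space, `a < b`, and `z : [a,b] → Z` continuous such that for every
`ε > 0` there is `t ∈ (a, a+ε]` (within the domain `[a,b]`) with `z t ≠ z a`.  Then for every
`α ∈ (0,1)` there exists a bounded continuous function `h : Z → ℝ` with `h (z a) = 0` such that
`sup_{t ∈ (a,b]} |h (z t) - h (z a)| / (t-a)^α = ∞`; in particular `t ↦ h (z t)` is not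
`α`-Hölder continuous on `[a,b]`. -/
theorem stmt_0 {Z : Type*} [MetricSpace Z] {a b : ℝ} (hab : a < b)
    (z : ℝ → Z) (hz : ContinuousOn z (Set.Icc a b))
    (hmove : ∀ ε > (0 : ℝ), ∃ t, t ∈ Set.Ioc a (a + ε) ∧ t ≤ b ∧ z t ≠ z a)
    (α : ℝ) (hα : α ∈ Set.Ioo (0 : ℝ) 1) :
    ∃ h : Z → ℝ, Continuous h ∧ (∃ M : ℝ, ∀ x : Z, |h x| ≤ M) ∧ h (z a) = 0 ∧
      (∀ M : ℝ, ∃ t ∈ Set.Ioc a b, M < |h (z t) - h (z a)| / (t - a) ^ α) ∧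
      ¬ ∃ C : ℝ, 0 ≤ C ∧ ∀ s ∈ Set.Icc a b, ∀ t ∈ Set.Icc a b,
          |h (z t) - h (z s)| ≤ C * |t - s| ^ α := by
  obtain ⟨hα0, -⟩ := hα
  have hseq : ∀ n : ℕ, ∃ t ∈ Set.Ioc a b, z t ≠ z a ∧ (t - a) ^ α ≤ (1 / 4 : ℝ) ^ n := by
    intro n
    have hq : (0 : ℝ) < (1 / 4 : ℝ) ^ n := by positivity
    obtain ⟨t, ht, htb, hne⟩ := hmove (((1 / 4 : ℝ) ^ n) ^ α⁻¹) (by positivity)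
    refine ⟨t, ⟨ht.1, htb⟩, hne, ?_⟩
    calc (t - a) ^ α ≤ (((1 / 4 : ℝ) ^ n) ^ α⁻¹) ^ α :=
          Real.rpow_le_rpow (by linarith [ht.1]) (by linarith [ht.2]) hα0.le
      _ = (1 / 4 : ℝ) ^ n := Real.rpow_inv_rpow hq.le hα0.ne'
  choose t ht hne hpow using hseq
  obtain ⟨h, hcont, hbdd, h0, hlow⟩ := exists_continuous_bounded_geometric_lower_bound
    (z a) (fun n => z (t n)) hne
  have hsup : ∀ M : ℝ, ∃ t ∈ Set.Ioc a b, M < |h (z t) - h (z a)| / (t - a) ^ α := by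
    intro M
    obtain ⟨n, hn⟩ := pow_unbounded_of_one_lt M (one_lt_two (α := ℝ))
    refine ⟨t n, ht n, hn.trans_le ?_⟩
    have hpos : 0 < (t n - a) ^ α := Real.rpow_pos_of_pos (sub_pos.2 (ht n).1) α
    rw [le_div_iff₀ hpos, h0, sub_zero]
    calc (2 : ℝ) ^ n * (t n - a) ^ α ≤ 2 ^ n * (1 / 4) ^ n := by gcongr; exact hpow n
      _ = (1 / 2) ^ n := by rw [← mul_pow]; norm_num
      _ ≤ |h (z (t n))| := (hlow n).trans (le_abs_self _)
  refine ⟨h, hcont, hbdd, h0, hsup, ?_⟩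
  rintro ⟨C, -, hC⟩
  obtain ⟨u, hu, hlt⟩ := hsup C
  have hpos : 0 < u - a := sub_pos.2 hu.1
  rw [lt_div_iff₀ (Real.rpow_pos_of_pos hpos α)] at hlt
  have hle := hC a (Set.left_mem_Icc.2 hab.le) u (Set.Ioc_subset_Icc_self hu)
  rw [abs_of_pos hpos] at hle
  exact hlt.not_ge hle
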